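/- arXiv:math/9809190 — 3 statements merged into one kernel-verified Lean document; each statement's English description precedes it below -/
import Mathlib

section
/- Let n be a positive integer, let G be a finite module over ZMod n, and let B : G →ₗ[ZMod n] G →ₗ[ZMod n] ZMod n be a perfect bilinear form. For any submodule Γ ≤ G, letting Γ⊥ = {x ∈ G : B x γ = 0 for all γ ∈ Γ} denote its orthogonal complement, one has (Nat.card Γ) * (Nat.card Γ⊥) = Nat.card G. -/
instance ZMod.hasEnoughRootsOfUnity_multiplicative (n : ℕ) :
    HasEnoughRootsOfUnity (Multiplicative (ZMod n)) n where
  prim := ⟨.ofAdd 1, by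
    rw [IsPrimitiveRoot.iff_orderOf, orderOf_ofAdd_eq_addOrderOf, ZMod.addOrderOf_one]⟩
  cyc := by
    have : IsCyclic (Multiplicative (ZMod n))ˣ :=
      isCyclic_of_surjective toUnits (toUnits (G := Multiplicative (ZMod n))).surjective
    infer_instance

/-- A finite module over `ZMod n` has the same order as its dual. -/
theorem ZMod.card_dual (n : ℕ) [NeZero n] (G : Type*) [AddCommGroup G] [Module (ZMod n) G]
    [Finite G] : Nat.card (Module.Dual (ZMod n) G) = Nat.card G := by
  have : HasEnoughRootsOfUnity (Multiplicative (ZMod n))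
      (Monoid.exponent (Multiplicative G)) :=
    .of_dvd (n := n) _ <| Monoid.exponent_dvd_of_forall_pow_eq_one fun g ↦
      congrArg Multiplicative.ofAdd (ZModModule.char_nsmul_eq_zero n g.toAdd)
  calc
    _ = Nat.card (Multiplicative G →* (Multiplicative (ZMod n))ˣ) :=
      Nat.card_congr <| (AddMonoidHom.toZModLinearMapEquiv n).symm.toEquiv.trans <|
        AddMonoidHom.toMultiplicative.trans toUnits.monoidHomCongrRight.toEquiv
    _ = Nat.card (Multiplicative G) := CommGroup.card_monoidHom_of_hasEnoughRootsOfUnity _ _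
    _ = Nat.card G := Nat.card_congr Multiplicative.toAdd

/-- The annihilator of a submodule of a finite module over `ZMod n` has the order of the
quotient. -/
theorem ZMod.card_dualAnnihilator (n : ℕ) [NeZero n] {G : Type*} [AddCommGroup G]
    [Module (ZMod n) G] [Finite G] (Γ : Submodule (ZMod n) G) :
    Nat.card Γ.dualAnnihilator = Nat.card (G ⧸ Γ) := by
  have : Finite (G ⧸ Γ) := Finite.of_surjective _ Γ.mkQ_surjective
  rw [← Nat.card_congr Γ.dualQuotEquivDualAnnihilator.toEquiv, ZMod.card_dual]

/-- For a perfect bilinear form on a finite module over `ZMod n`, the order of a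
submodule times the order of its orthogonal complement is the order of the module. -/
theorem card_mul_card_orthogonal
    (n : ℕ) (hn : 0 < n)
    (G : Type*) [AddCommGroup G] [Module (ZMod n) G] [Finite G]
    (B : G →ₗ[ZMod n] G →ₗ[ZMod n] ZMod n)
    (hB : Function.Bijective B)
    (Γ : Submodule (ZMod n) G) :
    Nat.card Γ * Nat.card {x : G | ∀ γ ∈ Γ, B x γ = 0} = Nat.card G := by
  have : NeZero n := ⟨hn.ne'⟩
  have h : Nat.card {x : G | ∀ γ ∈ Γ, B x γ = 0} = Nat.card Γ.dualAnnihilator :=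
    Nat.card_congr <| (Equiv.ofBijective B hB).subtypeEquiv fun x ↦ by
      simp [Submodule.mem_dualAnnihilator]
  rw [h, ZMod.card_dualAnnihilator, Submodule.card_eq_card_quotient_mul_card Γ]
end

section
/- Let n be a positive integer, let G be a finite module over ZMod n, and let B : G →ₗ[ZMod n] G →ₗ[ZMod n] ZMod n be a perfect bilinear form. If Γ ≤ G is an isotropic submodule, i.e. B x y = 0 for all x, y ∈ Γ, then (Nat.card Γ)^2 ≤ Nat.card G. -/
/-- A finite `ZMod n`-module has at most as many linear functionals as elements. -/
theorem card_dual_zmod_le (n : ℕ) [NeZero n] (M : Type*) [AddCommGroup M] [Module (ZMod n) M]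
    [Finite M] : Nat.card (M →ₗ[ZMod n] ZMod n) ≤ Nat.card M := by
  have := Fintype.ofFinite M
  have hcard : Nat.card (AddChar M ℂ) = Nat.card M := by
    rw [Nat.card_eq_fintype_card, Nat.card_eq_fintype_card, AddChar.card_eq]
  rw [← hcard]
  refine Nat.card_le_card_of_injective
    (fun f : M →ₗ[ZMod n] ZMod n ↦ ZMod.stdAddChar.compAddMonoidHom f.toAddMonoidHom) ?_
  intro f g hfg
  ext x
  exact ZMod.injective_stdAddChar (DFunLike.congr_fun hfg x)

/-- For a perfect bilinear form on a finite module over `ZMod n`, the square of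
the order of an isotropic submodule is at most the order of the module. -/
theorem sq_card_isotropic_le
    (n : ℕ) (hn : 0 < n)
    (G : Type*) [AddCommGroup G] [Module (ZMod n) G] [Finite G]
    (B : G →ₗ[ZMod n] G →ₗ[ZMod n] ZMod n)
    (hB : Function.Bijective B)
    (Γ : Submodule (ZMod n) G)
    (hiso : ∀ x ∈ Γ, ∀ y ∈ Γ, B x y = 0) :
    (Nat.card Γ) ^ 2 ≤ Nat.card G := by
  have : NeZero n := ⟨hn.ne'⟩
  have : Finite (G ⧸ Γ) := .of_surjective _ Γ.mkQ_surjective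
  have : Finite (G ⧸ Γ →ₗ[ZMod n] ZMod n) := DFunLike.finite _
  have hΓ : Nat.card Γ ≤ Nat.card (G ⧸ Γ →ₗ[ZMod n] ZMod n) := by
    refine Nat.card_le_card_of_injective
      (fun x : Γ ↦ Γ.liftQ (B x) fun y hy ↦ hiso x x.2 y hy) ?_
    intro x y hxy
    refine Subtype.ext (hB.injective (LinearMap.ext fun z ↦ ?_))
    exact LinearMap.congr_fun hxy (Γ.mkQ z)
  rw [Γ.card_eq_card_quotient_mul_card, sq, mul_comm]
  gcongr
  exact hΓ.trans (card_dual_zmod_le n (G ⧸ Γ))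
end

section
/- Let n be a positive integer, let M and N be finite modules over ZMod n equipped with perfect skew-symmetric bilinear forms e_M and e_N (perfect: the induced map to the ZMod n-linear dual is bijective; skew-symmetric: e(x,y) + e(y,x) = 0 for all x, y). Let ι : M ≃ₗ[ZMod n] N be an anti-symplectic isomorphism, i.e. e_N (ι x) (ι y) = e_M y x for all x, y ∈ M. Then the graph Γ = {(x, ι x) : x ∈ M} is a maximal isotropic submodule of M × N for the orthogonal-sum form E (a,b) (a',b') = e_M a a' + e_N b b': Γ is isotropic and Γ equals its orthogonal complement {z ∈ M × N : E z γ = 0 for all γ ∈ Γ}. -/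
/-- The graph of an anti-symplectic isomorphism between finite modules carrying
perfect skew-symmetric bilinear forms is a maximal isotropic submodule of the
product for the orthogonal-sum form: it is isotropic and equals its orthogonal
complement. -/
theorem graph_maximal_isotropic
    (n : ℕ) (hn : 0 < n)
    (M N : Type*) [AddCommGroup M] [AddCommGroup N]
    [Module (ZMod n) M] [Module (ZMod n) N] [Finite M] [Finite N]
    (eM : M →ₗ[ZMod n] M →ₗ[ZMod n] ZMod n)
    (eN : N →ₗ[ZMod n] N →ₗ[ZMod n] ZMod n)
    (hMperf : Function.Bijective eM)
    (hNperf : Function.Bijective eN)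
    (hMskew : ∀ x y : M, eM x y + eM y x = 0)
    (hNskew : ∀ x y : N, eN x y + eN y x = 0)
    (ι : M ≃ₗ[ZMod n] N)
    (hanti : ∀ x y : M, eN (ι x) (ι y) = eM y x)
    (E : (M × N) →ₗ[ZMod n] (M × N) →ₗ[ZMod n] ZMod n)
    (hE : ∀ (a : M) (b : N) (a' : M) (b' : N),
      E (a, b) (a', b') = eM a a' + eN b b') :
    (∀ x ∈ LinearMap.graph (ι : M →ₗ[ZMod n] N),
      ∀ y ∈ LinearMap.graph (ι : M →ₗ[ZMod n] N), E x y = 0) ∧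
    ((LinearMap.graph (ι : M →ₗ[ZMod n] N) : Set (M × N)) =
      {z : M × N | ∀ γ ∈ LinearMap.graph (ι : M →ₗ[ZMod n] N), E z γ = 0}) := by
  have isotropic : ∀ x ∈ LinearMap.graph (ι : M →ₗ[ZMod n] N),
      ∀ y ∈ LinearMap.graph (ι : M →ₗ[ZMod n] N), E x y = 0 := by
    rintro ⟨a, b⟩ hx ⟨a', b'⟩ hy
    obtain rfl : b = ι a := hx
    obtain rfl : b' = ι a' := hy
    rw [hE, hanti, hMskew]
  refine ⟨isotropic, Set.Subset.antisymm isotropic ?_⟩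
  rintro ⟨a, b⟩ hz
  obtain ⟨c, rfl⟩ := ι.surjective b
  have hac : a = c := by
    refine hMperf.injective (LinearMap.ext fun y => ?_)
    have h : E (a, ι c) (y, ι y) = 0 := hz (y, ι y) rfl
    rw [hE, hanti] at h
    exact add_right_cancel (h.trans (hMskew c y).symm)
  subst hac
  rfl
end
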